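/- There is no continuous function r : ℂ² → ℂ such that for every (a₀, a₁) ∈ ℂ², the value r(a₀, a₁) is a root of the polynomial z² + a₁·z + a₀, i.e., such that r(a₀,a₁)² + a₁·r(a₀,a₁) + a₀ = 0 for all (a₀,a₁) ∈ ℂ². -/

import Mathlib

/-- There is no continuous function `r : ℂ² → ℂ` such that `r (a₀, a₁)` is a root of
`z² + a₁·z + a₀` for all `(a₀, a₁) ∈ ℂ²`. -/
theorem no_continuous_root_quadratic_complex :
    ¬ ∃ r : ℂ × ℂ → ℂ, Continuous r ∧
      ∀ a₀ a₁ : ℂ, (r (a₀, a₁)) ^ 2 + a₁ * r (a₀, a₁) + a₀ = 0 := by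
  rintro ⟨r, hr, h⟩
  let g : ℝ → ℂ := fun t =>
    r (-Complex.exp (2 * (t * Complex.I)), 0) * Complex.exp (-(t * Complex.I))
  have hg : Continuous g := by
    refine (hr.comp (by fun_prop)).mul (by fun_prop)
  have hsq : ∀ t, g t ^ 2 = 1 := by
    intro t
    have h1 := h (-Complex.exp (2 * (t * Complex.I))) 0
    have h2 : r (-Complex.exp (2 * (t * Complex.I)), 0) ^ 2
        = Complex.exp (2 * (t * Complex.I)) := by linear_combination h1
    have h3 : Complex.exp (-(t * Complex.I)) ^ 2 = Complex.exp (-(2 * (t * Complex.I))) := by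
      rw [← Complex.exp_nat_mul]
      congr 1
      push_cast
      ring
    simp only [g]
    rw [mul_pow, h2, h3, ← Complex.exp_add, add_neg_cancel, Complex.exp_zero]
  have hne : ∀ t, (g t).re ≠ 0 := by
    intro t
    rcases (sq_eq_sq_iff_eq_or_eq_neg (b := (1:ℂ))).mp (by rw [hsq t, one_pow]) with h1 | h1 <;> rw [h1] <;> simp
  have hpi : g Real.pi = - g 0 := by
    have e1 : Complex.exp (2 * ((Real.pi : ℝ) * Complex.I)) = 1 := by
      rw [← mul_assoc]; exact Complex.exp_two_pi_mul_I
    have e2 : Complex.exp (-((Real.pi : ℝ) * Complex.I)) = -1 := by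
      rw [Complex.exp_neg, Complex.exp_pi_mul_I]; norm_num
    simp only [g]
    rw [e1, e2]
    simp
  have hpi' : (g Real.pi).re = - (g 0).re := by rw [hpi]; simp
  have hc : Continuous fun t => (g t).re := Complex.continuous_re.comp hg
  have : (0 : ℝ) ∈ Set.range fun t => (g t).re := by
    rcases le_total (g 0).re 0 with h0 | h0
    · exact mem_range_of_exists_le_of_exists_ge hc ⟨0, h0⟩ ⟨Real.pi, by rw [hpi']; linarith⟩
    · exact mem_range_of_exists_le_of_exists_ge hc ⟨Real.pi, by rw [hpi']; linarith⟩ ⟨0, h0⟩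
  obtain ⟨t, ht⟩ := this
  exact hne t ht
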